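/- Let U ∈ C₀^∞(K̄∖{0}) and V_t ∈ C^∞(K̄_t∖{0}) for t = 1,2. Then the following nonlocal Green formula holds: Σ_{t=1,2} ∫_{K_t} (−ΔU)·conj(V_t) dy + ∫_{γ₁} (∂U/∂n₁ + α·(∂U/∂r)(χ₁₂ r, φ+φ₁₂))·conj(−V₁) dγ + ∫_{γ₃} (∂U/∂n₃)·conj(−V₂) dγ + ∫_{γ₂} (∂U/∂n₂)·(conj(V₁) − conj(V₂)) dγ = Σ_{t=1,2} ∫_{K_t} U·conj(−ΔV_t) dy + ∫_{γ₁} (−U)·conj(∂V₁/∂n₁) dγ + ∫_{γ₃} (−U)·conj(∂V₂/∂n₃) dγ + ∫_{γ₂} U·conj( ∂V₁/∂n₂ − ∂V₂/∂n₂ + α·(χ'₂₁)²·(∂V₁/∂r)(χ'₂₁ r, φ+φ'₂₁) ) dγ. -/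

import Mathlib

open MeasureTheory Real Set ComplexConjugate

noncomputable section

/-- Open plane sector `{(r cos θ, r sin θ) : r > 0, a < θ < b}` (polar coordinates). -/
def sector (a b : ℝ) : Set (ℝ × ℝ) :=
  {y | ∃ r θ : ℝ, 0 < r ∧ a < θ ∧ θ < b ∧ y = (r * Real.cos θ, r * Real.sin θ)}

/-- Directional derivative of `W` in the direction `v`. -/
def dd (W : ℝ × ℝ → ℂ) (v : ℝ × ℝ) (y : ℝ × ℝ) : ℂ := fderiv ℝ W y v

/-- Laplacian on `ℝ²`. -/
def lap (W : ℝ × ℝ → ℂ) (y : ℝ × ℝ) : ℂ :=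
  dd (dd W (1, 0)) (1, 0) y + dd (dd W (0, 1)) (0, 1) y

/-- Rotation by the angle `ψ` composed with dilation by the factor `χ`:
in polar coordinates `(r, φ) ↦ (χ r, φ + ψ)`. -/
def rotDil (χ ψ : ℝ) (y : ℝ × ℝ) : ℝ × ℝ :=
  (χ * (y.1 * Real.cos ψ - y.2 * Real.sin ψ), χ * (y.1 * Real.sin ψ + y.2 * Real.cos ψ))

/-- Arclength integral over the ray `φ = b`: `∫_{γ} h dγ = ∫₀^∞ h(r, b) dr`. -/
def rayInt (b : ℝ) (h : ℝ × ℝ → ℂ) : ℂ :=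
  ∫ r in Set.Ioi (0 : ℝ), h (r * Real.cos b, r * Real.sin b)

/-- `W` is smooth on an open neighbourhood of the set `s`
(the formalization of `W ∈ C^∞(s)` for a non-open `s`). -/
def SmoothNear (W : ℝ × ℝ → ℂ) (s : Set (ℝ × ℝ)) : Prop :=
  ∃ O : Set (ℝ × ℝ), IsOpen O ∧ s ⊆ O ∧ ContDiffOn ℝ (⊤ : ℕ∞) W O

lemma polarCoord_symm_mem_closure_sector {a b : ℝ} (hab : a < b) {r θ : ℝ} (hr : 0 < r)
    (hθ : θ ∈ Icc a b) : polarCoord.symm (r, θ) ∈ closure (sector a b) \ {0} := by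
  constructor
  · have hc : Continuous fun t : ℝ => polarCoord.symm (r, t) := by fun_prop
    have hmaps : MapsTo (fun t : ℝ => polarCoord.symm (r, t)) (Ioo a b) (sector a b) :=
      fun t ht => ⟨r, t, hr, ht.1, ht.2, rfl⟩
    exact hmaps.closure hc (by rwa [closure_Ioo hab.ne])
  · intro h
    simp only [mem_singleton_iff, polarCoord_symm_apply, Prod.mk_eq_zero, mul_eq_zero, hr.ne',
      false_or] at h
    have := Real.sin_sq_add_cos_sq θ
    simp [h.1, h.2] at this

lemma sector_eq_image (a b : ℝ) : sector a b = polarCoord.symm '' (Ioi 0 ×ˢ Ioo a b) := by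
  ext y
  constructor
  · rintro ⟨r, θ, hr, ha, hb, rfl⟩
    exact ⟨(r, θ), ⟨hr, ha, hb⟩, rfl⟩
  · rintro ⟨⟨r, θ⟩, ⟨hr, ha, hb⟩, rfl⟩
    exact ⟨r, θ, hr, ha, hb, rfl⟩

lemma injOn_polarCoord_symm {a b : ℝ} (hab : b - a < 2 * π) :
    InjOn polarCoord.symm (Ioi 0 ×ˢ Ioo a b) := by
  rintro ⟨r, s⟩ ⟨hr, hs⟩ ⟨r', s'⟩ ⟨hr', hs'⟩ h
  simp only [mem_Ioi, mem_Ioo] at hr hs hr' hs'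
  simp only [polarCoord_symm_apply, Prod.mk.injEq] at h
  obtain ⟨h1, h2⟩ := h
  have hrr : r = r' := by
    have : r ^ 2 = r' ^ 2 := by
      linear_combination (r * Real.cos s + r' * Real.cos s') * h1 +
        (r * Real.sin s + r' * Real.sin s') * h2 - r ^ 2 * Real.sin_sq_add_cos_sq s +
        r' ^ 2 * Real.sin_sq_add_cos_sq s'
    exact (pow_left_inj₀ hr.le hr'.le two_ne_zero).1 this
  subst hrr
  have hc : Real.cos s = Real.cos s' := mul_left_cancel₀ hr.ne' h1
  have hs2 : Real.sin s = Real.sin s' := mul_left_cancel₀ hr.ne' h2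
  have h3 : Real.cos (s - s') = 1 := by
    rw [Real.cos_sub, hc, hs2]
    linear_combination Real.sin_sq_add_cos_sq s'
  have h4 := (Real.cos_eq_one_iff_of_lt_of_lt (by linarith [hs.1, hs'.2])
    (by linarith [hs.2, hs'.1])).1 h3
  rw [sub_eq_zero.1 h4]

lemma measurableSet_sector {a b : ℝ} (hab : b - a < 2 * π) : MeasurableSet (sector a b) := by
  rw [sector_eq_image]
  exact (measurableSet_Ioi.prod measurableSet_Ioo).image_of_continuousOn_injOn
    continuous_polarCoord_symm.continuousOn (injOn_polarCoord_symm hab)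

lemma integral_sector {a b : ℝ} (hab : b - a < 2 * π) (f : ℝ × ℝ → ℂ) :
    ∫ y in sector a b, f y = ∫ p : ℝ × ℝ in Ioi 0 ×ˢ Ioo a b, (p.1 : ℂ) * f (polarCoord.symm p) := by
  have hm : MeasurableSet (Ioi (0 : ℝ) ×ˢ Ioo a b) := measurableSet_Ioi.prod measurableSet_Ioo
  rw [sector_eq_image, integral_image_eq_integral_abs_det_fderiv_smul volume hm
    (fun p _ => (hasFDerivAt_polarCoord_symm p).hasFDerivWithinAt) (injOn_polarCoord_symm hab)]
  refine setIntegral_congr_fun hm fun p hp => ?_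
  simp only [det_fderivPolarCoordSymm]
  rw [abs_of_pos hp.1, Complex.real_smul]

/-- A compact set avoiding the origin lies in an annulus. -/
lemma exists_annulus {K : Set (ℝ × ℝ)} (hK : IsCompact K) (h0 : (0 : ℝ × ℝ) ∉ K) :
    ∃ ε R : ℝ, 0 < ε ∧ ε < R ∧
      ∀ r θ : ℝ, 0 < r → polarCoord.symm (r, θ) ∈ K → ε < r ∧ r < R := by
  obtain ⟨ε, hε, hεK⟩ := Metric.isOpen_iff.1 hK.isClosed.isOpen_compl 0 h0
  obtain ⟨C, hC⟩ := hK.isBounded.exists_norm_le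
  refine ⟨ε / 2, |C| * 2 + ε + 1, by positivity, by linarith [abs_nonneg C], fun r θ hr h => ?_⟩
  have hc : |r * Real.cos θ| ≤ r := by
    rw [abs_mul, abs_of_pos hr]
    exact mul_le_of_le_one_right hr.le (Real.abs_cos_le_one θ)
  have hs : |r * Real.sin θ| ≤ r := by
    rw [abs_mul, abs_of_pos hr]
    exact mul_le_of_le_one_right hr.le (Real.abs_sin_le_one θ)
  constructor
  · by_contra! hle
    refine hεK ?_ h
    rw [mem_ball_zero_iff, polarCoord_symm_apply, Prod.norm_def]
    exact max_lt (by simp only [Real.norm_eq_abs]; linarith)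
      (by simp only [Real.norm_eq_abs]; linarith)
  · have h1 := hC _ h
    rw [polarCoord_symm_apply, Prod.norm_def] at h1
    simp only [Real.norm_eq_abs] at h1
    have hx : |r * Real.cos θ| ≤ |C| := (le_max_left _ _).trans (h1.trans (le_abs_self C))
    have hy : |r * Real.sin θ| ≤ |C| := (le_max_right _ _).trans (h1.trans (le_abs_self C))
    have h2 : r ^ 2 ≤ (2 * |C|) ^ 2 := by
      have e : r ^ 2 = (r * Real.cos θ) ^ 2 + (r * Real.sin θ) ^ 2 := by
        linear_combination -r ^ 2 * Real.sin_sq_add_cos_sq θ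
      have hx2 := sq_le_sq' (by linarith [abs_nonneg (r * Real.cos θ)]) hx
      have hy2 := sq_le_sq' (by linarith [abs_nonneg (r * Real.sin θ)]) hy
      rw [sq_abs] at hx2 hy2
      nlinarith [sq_nonneg |C|]
    have := (pow_le_pow_iff_left₀ hr.le (by positivity) two_ne_zero).1 h2
    linarith

lemma dd_eq_zero_of_notMem {K : Set (ℝ × ℝ)} (hK : IsClosed K) {W : ℝ × ℝ → ℂ}
    (hW : ∀ y ∉ K, W y = 0) (v : ℝ × ℝ) : ∀ y ∉ K, dd W v y = 0 := by
  intro y hy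
  have : W =ᶠ[nhds y] fun _ => 0 := by
    filter_upwards [hK.isOpen_compl.mem_nhds hy] with z hz using hW z hz
  simp [dd, this.fderiv_eq]

lemma dd_comb (W : ℝ × ℝ → ℂ) (x z : ℝ) (y : ℝ × ℝ) :
    dd W (x, z) y = (x : ℂ) * dd W (1, 0) y + (z : ℂ) * dd W (0, 1) y := by
  have : ((x, z) : ℝ × ℝ) = x • ((1, 0) : ℝ × ℝ) + z • ((0, 1) : ℝ × ℝ) := by simp
  rw [this]
  simp only [dd, map_add, map_smul, Complex.real_smul]

lemma dd_conj (W : ℝ × ℝ → ℂ) (v : ℝ × ℝ) :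
    dd (fun y => conj (W y)) v = fun y => conj (dd W v y) := by
  funext y
  have := Complex.conjCLE.comp_fderiv (f := W) (x := y)
  change fderiv ℝ (Complex.conjCLE ∘ W) y v = _
  rw [this]
  rfl

lemma lap_conj (W : ℝ × ℝ → ℂ) (y : ℝ × ℝ) :
    lap (fun y => conj (W y)) y = conj (lap W y) := by
  simp only [lap, dd_conj, map_add]

lemma contDiffOn_dd {W : ℝ × ℝ → ℂ} {O : Set (ℝ × ℝ)} (hO : IsOpen O)
    (hW : ContDiffOn ℝ (⊤ : ℕ∞) W O) (v : ℝ × ℝ) : ContDiffOn ℝ (⊤ : ℕ∞) (dd W v) O :=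
  (hW.fderiv_of_isOpen hO (by simp)).clm_apply contDiffOn_const

lemma continuousOn_lap {W : ℝ × ℝ → ℂ} {O : Set (ℝ × ℝ)} (hO : IsOpen O)
    (hW : ContDiffOn ℝ (⊤ : ℕ∞) W O) : ContinuousOn (lap W) O :=
  ((contDiffOn_dd hO (contDiffOn_dd hO hW _) _).continuousOn).add ((contDiffOn_dd hO (contDiffOn_dd hO hW _) _).continuousOn)

lemma integrableOn_Ioi_of_annulus {g : ℝ → ℂ} {ε R : ℝ} (hε : 0 < ε)
    (hg : ContinuousOn g (Ioi 0)) (h : ∀ r, 0 < r → g r ≠ 0 → ε < r ∧ r < R) :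
    IntegrableOn g (Ioi 0) := by
  have h1 : IntegrableOn g (Icc ε R) :=
    (hg.mono fun r hr => lt_of_lt_of_le hε hr.1).integrableOn_compact isCompact_Icc
  refine h1.of_forall_sdiff_eq_zero measurableSet_Ioi fun r hr => ?_
  by_contra hne
  have := h r hr.1 hne
  exact hr.2 ⟨this.1.le, this.2.le⟩

lemma integrableOn_ray {O K : Set (ℝ × ℝ)} {h : ℝ × ℝ → ℂ} {b : ℝ}
    (hO : ∀ r : ℝ, 0 < r → polarCoord.symm (r, b) ∈ O) (hh : ContinuousOn h O)
    (hK : IsCompact K) (h0 : (0 : ℝ × ℝ) ∉ K) (hz : ∀ y ∉ K, h y = 0) :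
    IntegrableOn (fun r : ℝ => h (r * Real.cos b, r * Real.sin b)) (Ioi 0) := by
  obtain ⟨ε, R, hε, -, H⟩ := exists_annulus hK h0
  refine integrableOn_Ioi_of_annulus (ε := ε) (R := R) hε ?_ fun r hr hne => H r b hr ?_
  · exact hh.comp (f := fun r : ℝ => (r * Real.cos b, r * Real.sin b)) (by fun_prop)
      fun r hr => hO r hr
  · by_contra hn
    exact hne (hz _ hn)

lemma integrableOn_sector {a b : ℝ} (hab : b - a < 2 * π) {O K : Set (ℝ × ℝ)} {f : ℝ × ℝ → ℂ}
    (hO : closure (sector a b) \ {0} ⊆ O) (hf : ContinuousOn f O)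
    (hK : IsCompact K) (h0 : (0 : ℝ × ℝ) ∉ K) (hz : ∀ y ∉ K, f y = 0) :
    IntegrableOn f (sector a b) := by
  have h1 : IntegrableOn f (K ∩ closure (sector a b)) := by
    refine (hf.mono fun y hy => hO ⟨hy.2, ?_⟩).integrableOn_compact
      (hK.inter_right isClosed_closure)
    rintro rfl
    exact h0 hy.1
  refine h1.of_forall_sdiff_eq_zero (measurableSet_sector hab) fun y hy => hz y fun hyK => ?_
  exact hy.2 ⟨hyK, subset_closure hy.1⟩

lemma fderivPolarCoordSymm_apply (p v : ℝ × ℝ) :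
    fderivPolarCoordSymm p v = (Real.cos p.2 * v.1 - p.1 * Real.sin p.2 * v.2,
      Real.sin p.2 * v.1 + p.1 * Real.cos p.2 * v.2) := by
  unfold fderivPolarCoordSymm
  rw [Matrix.toLin_finTwoProd_toContinuousLinearMap]
  simp [sub_eq_add_neg]

/-- The divergence in polar coordinates. -/
lemma polar_divergence {P Q : ℝ × ℝ → ℂ} {p : ℝ × ℝ}
    (hP : DifferentiableAt ℝ P (polarCoord.symm p))
    (hQ : DifferentiableAt ℝ Q (polarCoord.symm p)) :
    ∃ f' g' : ℝ × ℝ →L[ℝ] ℂ,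
      HasFDerivAt (fun p : ℝ × ℝ => (p.1 : ℂ) * ((Real.cos p.2 : ℂ) * P (polarCoord.symm p) +
        (Real.sin p.2 : ℂ) * Q (polarCoord.symm p))) f' p ∧
      HasFDerivAt (fun p : ℝ × ℝ => -(Real.sin p.2 : ℂ) * P (polarCoord.symm p) +
        (Real.cos p.2 : ℂ) * Q (polarCoord.symm p)) g' p ∧
      f' (1, 0) + g' (0, 1) =
        p.1 * (dd P (1, 0) (polarCoord.symm p) + dd Q (0, 1) (polarCoord.symm p)) := by
  have h1 : HasFDerivAt (fun p : ℝ × ℝ => (p.1 : ℂ)) _ p :=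
    Complex.ofRealCLM.hasFDerivAt.comp p hasFDerivAt_fst
  have hc : HasFDerivAt (fun p : ℝ × ℝ => (Real.cos p.2 : ℂ)) _ p :=
    Complex.ofRealCLM.hasFDerivAt.comp p
      ((Real.hasDerivAt_cos p.2).comp_hasFDerivAt p hasFDerivAt_snd)
  have hs : HasFDerivAt (fun p : ℝ × ℝ => (Real.sin p.2 : ℂ)) _ p :=
    Complex.ofRealCLM.hasFDerivAt.comp p
      ((Real.hasDerivAt_sin p.2).comp_hasFDerivAt p hasFDerivAt_snd)
  have hP' : HasFDerivAt (fun p => P (polarCoord.symm p)) _ p :=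
    hP.hasFDerivAt.comp p (hasFDerivAt_polarCoord_symm p)
  have hQ' : HasFDerivAt (fun p => Q (polarCoord.symm p)) _ p :=
    hQ.hasFDerivAt.comp p (hasFDerivAt_polarCoord_symm p)
  have hs' : HasFDerivAt (fun p : ℝ × ℝ => -(Real.sin p.2 : ℂ)) _ p := hs.neg
  refine ⟨_, _, h1.mul ((hc.mul hP').add (hs.mul hQ')),
    (hs'.mul hP').add (hc.mul hQ'), ?_⟩
  have e := fun (W : ℝ × ℝ → ℂ) (x z : ℝ) => dd_comb W x z (polarCoord.symm p)
  simp only [dd] at e ⊢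
  have hcs : (Real.sin p.2 : ℂ) ^ 2 + (Real.cos p.2 : ℂ) ^ 2 = 1 := by
    exact_mod_cast Real.sin_sq_add_cos_sq p.2
  simp only [_root_.add_apply, _root_.smul_apply,
    ContinuousLinearMap.comp_apply, _root_.neg_apply, fderivPolarCoordSymm_apply,
    ContinuousLinearMap.coe_fst', ContinuousLinearMap.coe_snd', Complex.ofRealCLM_apply,
    smul_eq_mul, mul_zero, mul_one, sub_zero, add_zero, zero_add, zero_sub]
  rw [e P (Real.cos p.2), e Q (Real.cos p.2), e P (-(p.1 * Real.sin p.2)),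
    e Q (-(p.1 * Real.sin p.2))]
  push_cast
  push_cast at hcs
  linear_combination (p.1 : ℂ) * (fderiv ℝ P (polarCoord.symm p) (1, 0) +
    fderiv ℝ Q (polarCoord.symm p) (0, 1)) * hcs

/-- The divergence theorem on a plane sector for fields supported away from the vertex. -/
lemma integral_divergence_sector {a b : ℝ} (hlt : a < b) (hab : b - a < 2 * π)
    {O K : Set (ℝ × ℝ)} {P Q : ℝ × ℝ → ℂ} (hO : IsOpen O)
    (hsub : closure (sector a b) \ {0} ⊆ O)
    (hP : ContDiffOn ℝ (⊤ : ℕ∞) P O) (hQ : ContDiffOn ℝ (⊤ : ℕ∞) Q O)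
    (hK : IsCompact K) (h0 : (0 : ℝ × ℝ) ∉ K)
    (hPK : ∀ y ∉ K, P y = 0) (hQK : ∀ y ∉ K, Q y = 0) :
    ∫ y in sector a b, (dd P (1, 0) y + dd Q (0, 1) y) =
      rayInt b (fun y => -(Real.sin b : ℂ) * P y + (Real.cos b : ℂ) * Q y) -
      rayInt a (fun y => -(Real.sin a : ℂ) * P y + (Real.cos a : ℂ) * Q y) := by
  obtain ⟨ε, R, hε, hεR, H⟩ := exists_annulus hK h0
  have hmem : ∀ p ∈ Icc ε R ×ˢ Icc a b, polarCoord.symm p ∈ O := fun p hp =>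
    hsub (polarCoord_symm_mem_closure_sector hlt (hε.trans_le hp.1.1) hp.2)
  have hoff : ∀ r θ : ℝ, 0 < r → r ∉ Ioo ε R → polarCoord.symm (r, θ) ∉ K :=
    fun r θ hr hn hk => hn (H r θ hr hk)
  set D : ℝ × ℝ → ℂ := fun y => dd P (1, 0) y + dd Q (0, 1) y with hD
  have hDK : ∀ y ∉ K, D y = 0 := fun y hy => by
    simp [hD, dd_eq_zero_of_notMem hK.isClosed hPK _ y hy,
      dd_eq_zero_of_notMem hK.isClosed hQK _ y hy]
  have hDc : ContinuousOn D O := (contDiffOn_dd hO hP _).continuousOn.add (contDiffOn_dd hO hQ _).continuousOn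
  have hpc : ContinuousOn polarCoord.symm (Icc ε R ×ˢ Icc a b) :=
    continuous_polarCoord_symm.continuousOn
  have hG : ContinuousOn (fun p : ℝ × ℝ => (p.1 : ℂ) * D (polarCoord.symm p))
      (Icc ε R ×ˢ Icc a b) := by
    refine ContinuousOn.mul (by fun_prop) (hDc.comp hpc hmem)
  have hGi := hG.integrableOn_compact (μ := volume) (isCompact_Icc.prod isCompact_Icc)
  have hPc := hP.continuousOn.comp hpc hmem
  have hQc := hQ.continuousOn.comp hpc hmem
  set f : ℝ × ℝ → ℂ := fun p => (p.1 : ℂ) * ((Real.cos p.2 : ℂ) * P (polarCoord.symm p) +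
    (Real.sin p.2 : ℂ) * Q (polarCoord.symm p)) with hf
  set g : ℝ × ℝ → ℂ := fun p => -(Real.sin p.2 : ℂ) * P (polarCoord.symm p) +
    (Real.cos p.2 : ℂ) * Q (polarCoord.symm p) with hg
  have hfc : ContinuousOn f (Icc ε R ×ˢ Icc a b) :=
    ContinuousOn.mul (by fun_prop) ((ContinuousOn.mul (by fun_prop) hPc).add
      (ContinuousOn.mul (by fun_prop) hQc))
  have hgc : ContinuousOn g (Icc ε R ×ˢ Icc a b) :=
    (ContinuousOn.mul (by fun_prop) hPc).add (ContinuousOn.mul (by fun_prop) hQc)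
  have hPd : ∀ p ∈ Icc ε R ×ˢ Icc a b, DifferentiableAt ℝ P (polarCoord.symm p) := fun p hp =>
    (hP.contDiffAt (hO.mem_nhds (hmem p hp))).differentiableAt (by simp)
  have hQd : ∀ p ∈ Icc ε R ×ˢ Icc a b, DifferentiableAt ℝ Q (polarCoord.symm p) := fun p hp =>
    (hQ.contDiffAt (hO.mem_nhds (hmem p hp))).differentiableAt (by simp)
  have hex := fun p (hp : p ∈ Icc ε R ×ˢ Icc a b) => polar_divergence (hPd p hp) (hQd p hp)
  have hf' : ∀ p ∈ Icc ε R ×ˢ Icc a b, HasFDerivAt f (fderiv ℝ f p) p := fun p hp => by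
    obtain ⟨f', g', h1, h2, h3⟩ := hex p hp
    exact h1.differentiableAt.hasFDerivAt
  have hg' : ∀ p ∈ Icc ε R ×ˢ Icc a b, HasFDerivAt g (fderiv ℝ g p) p := fun p hp => by
    obtain ⟨f', g', h1, h2, h3⟩ := hex p hp
    exact h2.differentiableAt.hasFDerivAt
  have hdiv : ∀ p ∈ Icc ε R ×ˢ Icc a b, fderiv ℝ f p (1, 0) + fderiv ℝ g p (0, 1) =
      (p.1 : ℂ) * D (polarCoord.symm p) := fun p hp => by
    obtain ⟨f', g', h1, h2, h3⟩ := hex p hp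
    rw [← h3, ← h1.fderiv, ← h2.fderiv]
  have hm : MeasurableSet (Icc ε R ×ˢ Icc a b) := measurableSet_Icc.prod measurableSet_Icc
  have hfg_int : IntegrableOn (fun p => fderiv ℝ f p (1, 0) + fderiv ℝ g p (0, 1))
      (Icc ε R ×ˢ Icc a b) := hGi.congr_fun (fun p hp => (hdiv p hp).symm) hm
  have hle := hεR.le
  have key := integral2_divergence_prod_of_hasFDerivAt f g (fderiv ℝ f) (fderiv ℝ g) ε a R b
    (by rwa [uIcc_of_le hle, uIcc_of_le hlt.le]) (by rwa [uIcc_of_le hle, uIcc_of_le hlt.le])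
    (fun p hp => hf' p (by
      rw [min_eq_left hle, max_eq_right hle, min_eq_left hlt.le, max_eq_right hlt.le] at hp
      exact ⟨Ioo_subset_Icc_self hp.1, Ioo_subset_Icc_self hp.2⟩))
    (fun p hp => hg' p (by
      rw [min_eq_left hle, max_eq_right hle, min_eq_left hlt.le, max_eq_right hlt.le] at hp
      exact ⟨Ioo_subset_Icc_self hp.1, Ioo_subset_Icc_self hp.2⟩))
    (by rwa [uIcc_of_le hle, uIcc_of_le hlt.le])
  have hfε : ∀ θ, f (ε, θ) = 0 := fun θ => by
    have := hoff ε θ hε (by simp)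
    simp only [hf, hPK _ this, hQK _ this, mul_zero, add_zero]
  have hfR : ∀ θ, f (R, θ) = 0 := fun θ => by
    have := hoff R θ (hε.trans hεR) (by simp)
    simp only [hf, hPK _ this, hQK _ this, mul_zero, add_zero]
  have hray : ∀ θ : ℝ, rayInt θ (fun y => -(Real.sin θ : ℂ) * P y + (Real.cos θ : ℂ) * Q y) =
      ∫ r in ε..R, g (r, θ) := fun θ => by
    rw [intervalIntegral.integral_of_le hle, rayInt]
    refine setIntegral_eq_of_subset_of_forall_sdiff_eq_zero measurableSet_Ioi
      (fun r hr => hε.trans hr.1) fun r hr => ?_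
    have := hoff r θ hr.1 fun h => hr.2 (Ioo_subset_Ioc_self h)
    rw [polarCoord_symm_apply] at this
    simp only [hPK _ this, hQK _ this, mul_zero, add_zero]
  simp only [hfε, hfR, intervalIntegral.integral_zero, add_zero, sub_zero] at key
  rw [hray, hray, ← key, integral_sector hab]
  have hset : ∫ p : ℝ × ℝ in Ioi 0 ×ˢ Ioo a b, (p.1 : ℂ) * D (polarCoord.symm p) =
      ∫ p : ℝ × ℝ in Ioo ε R ×ˢ Ioo a b, (p.1 : ℂ) * D (polarCoord.symm p) := by
    refine setIntegral_eq_of_subset_of_forall_sdiff_eq_zero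
      (measurableSet_Ioi.prod measurableSet_Ioo)
      (fun p hp => ⟨hε.trans hp.1.1, hp.2⟩) fun p hp => ?_
    have := hoff p.1 p.2 hp.1.1 fun h => hp.2 ⟨h, hp.1.2⟩
    rw [hDK _ this, mul_zero]
  rw [hset, Measure.volume_eq_prod, setIntegral_prod _
    (hGi.mono_set (prod_mono Ioo_subset_Icc_self Ioo_subset_Icc_self)),
    intervalIntegral.integral_of_le hle, integral_Ioc_eq_integral_Ioo]
  refine setIntegral_congr_fun measurableSet_Ioo fun r hr => ?_
  simp only
  rw [intervalIntegral.integral_of_le hlt.le, integral_Ioc_eq_integral_Ioo]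
  refine setIntegral_congr_fun measurableSet_Ioo fun θ hθ => ?_
  exact (hdiv (r, θ) ⟨Ioo_subset_Icc_self hr, Ioo_subset_Icc_self hθ⟩).symm

lemma dd_mul {F G : ℝ × ℝ → ℂ} {y : ℝ × ℝ} (hF : DifferentiableAt ℝ F y)
    (hG : DifferentiableAt ℝ G y) (v : ℝ × ℝ) :
    dd (fun y => F y * G y) v y = F y * dd G v y + dd F v y * G y := by
  simp only [dd]
  rw [fderiv_fun_mul hF hG]
  simp [mul_comm]

/-- The divergence of the field `U ∇W - W ∇U`, one coordinate at a time. -/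
lemma dd_green_field {U W : ℝ × ℝ → ℂ} {O : Set (ℝ × ℝ)} (hO : IsOpen O)
    (hU : ContDiffOn ℝ (⊤ : ℕ∞) U O) (hW : ContDiffOn ℝ (⊤ : ℕ∞) W O) {y : ℝ × ℝ} (hy : y ∈ O)
    (v : ℝ × ℝ) :
    dd (fun y => U y * dd W v y - dd U v y * W y) v y =
      U y * dd (dd W v) v y - dd (dd U v) v y * W y := by
  have hd : ∀ {F : ℝ × ℝ → ℂ}, ContDiffOn ℝ (⊤ : ℕ∞) F O → DifferentiableAt ℝ F y := fun hF =>
    (hF.contDiffAt (hO.mem_nhds hy)).differentiableAt (by simp)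
  have hU1 := hd (contDiffOn_dd hO hU v)
  have hW1 := hd (contDiffOn_dd hO hW v)
  have h : dd (fun y => U y * dd W v y - dd U v y * W y) v y =
      dd (fun y => U y * dd W v y) v y - dd (fun y => dd U v y * W y) v y := by
    exact congrArg (fun L : ℝ × ℝ →L[ℝ] ℂ => L v)
      (fderiv_fun_sub ((hd hU).fun_mul hW1) (hU1.fun_mul (hd hW)))
  rw [h, dd_mul (hd hU) hW1, dd_mul hU1 (hd hW)]
  ring

lemma contDiffOn_conj {V : ℝ × ℝ → ℂ} {O : Set (ℝ × ℝ)} (hV : ContDiffOn ℝ (⊤ : ℕ∞) V O) :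
    ContDiffOn ℝ (⊤ : ℕ∞) (fun y => conj (V y)) O :=
  Complex.conjCLE.contDiff.comp_contDiffOn hV

/-- Green's second identity on a plane sector. -/
lemma green_sector {a b : ℝ} (hlt : a < b) (hab : b - a < 2 * π)
    {O K : Set (ℝ × ℝ)} {U V : ℝ × ℝ → ℂ} (hO : IsOpen O)
    (hsub : closure (sector a b) \ {0} ⊆ O)
    (hU : ContDiffOn ℝ (⊤ : ℕ∞) U O) (hV : ContDiffOn ℝ (⊤ : ℕ∞) V O)
    (hK : IsCompact K) (h0 : (0 : ℝ × ℝ) ∉ K) (hUK : ∀ y ∉ K, U y = 0) :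
    (∫ y in sector a b, (-(lap U y)) * conj (V y)) -
        ∫ y in sector a b, U y * conj (-(lap V y)) =
      (rayInt a (fun y => dd U (-Real.sin a, Real.cos a) y * conj (V y)) -
        rayInt a (fun y => U y * conj (dd V (-Real.sin a, Real.cos a) y))) -
      (rayInt b (fun y => dd U (-Real.sin b, Real.cos b) y * conj (V y)) -
        rayInt b (fun y => U y * conj (dd V (-Real.sin b, Real.cos b) y))) := by
  set W : ℝ × ℝ → ℂ := fun y => conj (V y) with hWdef
  have hW : ContDiffOn ℝ (⊤ : ℕ∞) W O := contDiffOn_conj hV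
  have hddU := fun v => dd_eq_zero_of_notMem hK.isClosed hUK v
  have hlapU : ∀ y ∉ K, lap U y = 0 := fun y hy => by
    simp [lap, dd_eq_zero_of_notMem hK.isClosed (hddU _) _ y hy]
  have hlapV : ∀ y, conj (-(lap V y)) = -(lap W y) := fun y => by
    rw [hWdef, lap_conj, map_neg]
  have hddV : ∀ v y, conj (dd V v y) = dd W v y := fun v y => by rw [hWdef, dd_conj]
  simp only [hlapV, hddV]
  have hray : ∀ θ ∈ Icc a b, rayInt θ (fun y =>
      -(Real.sin θ : ℂ) * (U y * dd W (1, 0) y - dd U (1, 0) y * W y) +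
        (Real.cos θ : ℂ) * (U y * dd W (0, 1) y - dd U (0, 1) y * W y)) =
      rayInt θ (fun y => U y * dd W (-Real.sin θ, Real.cos θ) y) -
        rayInt θ (fun y => dd U (-Real.sin θ, Real.cos θ) y * W y) := fun θ hθ => by
    have hmem : ∀ r : ℝ, 0 < r → polarCoord.symm (r, θ) ∈ O := fun r hr =>
      hsub (polarCoord_symm_mem_closure_sector hlt hr hθ)
    have h1 := integrableOn_ray (b := θ)
      (h := fun y => U y * dd W (-Real.sin θ, Real.cos θ) y) hmem
      (hU.continuousOn.mul (contDiffOn_dd hO hW _).continuousOn) hK h0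
      (fun y hy => by rw [hUK y hy, zero_mul])
    have h2 := integrableOn_ray (b := θ)
      (h := fun y => dd U (-Real.sin θ, Real.cos θ) y * W y) hmem
      ((contDiffOn_dd hO hU _).continuousOn.mul hW.continuousOn) hK h0
      (fun y hy => by rw [hddU _ y hy, zero_mul])
    simp only [rayInt]
    rw [← integral_sub h1 h2]
    congr 1
    funext r
    rw [dd_comb W (-Real.sin θ), dd_comb U (-Real.sin θ)]
    push_cast
    ring
  have hi1 : IntegrableOn (fun y => (-(lap U y)) * W y) (sector a b) :=
    integrableOn_sector hab hsub ((continuousOn_lap hO hU).neg.mul hW.continuousOn) hK h0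
      (fun y hy => by rw [hlapU y hy, neg_zero, zero_mul])
  have hi2 : IntegrableOn (fun y => U y * -(lap W y)) (sector a b) :=
    integrableOn_sector hab hsub (hU.continuousOn.mul (continuousOn_lap hO hW).neg) hK h0
      (fun y hy => by rw [hUK y hy, zero_mul])
  have hfield : ∀ v, ContDiffOn ℝ (⊤ : ℕ∞) (fun y => U y * dd W v y - dd U v y * W y) O :=
    fun v => (hU.mul (contDiffOn_dd hO hW v)).sub ((contDiffOn_dd hO hU v).mul hW)
  have hdiv := integral_divergence_sector hlt hab hO hsub (hfield (1, 0)) (hfield (0, 1)) hK h0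
    (fun y hy => by rw [hUK y hy, hddU _ y hy]; ring)
    (fun y hy => by rw [hUK y hy, hddU _ y hy]; ring)
  rw [hray a (left_mem_Icc.2 hlt.le), hray b (right_mem_Icc.2 hlt.le)] at hdiv
  have hcongr : ∫ y in sector a b, ((-(lap U y)) * W y - U y * -(lap W y)) =
      ∫ y in sector a b, (dd (fun y => U y * dd W (1, 0) y - dd U (1, 0) y * W y) (1, 0) y +
        dd (fun y => U y * dd W (0, 1) y - dd U (0, 1) y * W y) (0, 1) y) := by
    refine setIntegral_congr_fun (measurableSet_sector hab) fun y hy => ?_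
    have hyO : y ∈ O := by
      obtain ⟨r, θ, hr, ha, hb, rfl⟩ := hy
      exact hsub (polarCoord_symm_mem_closure_sector hlt hr ⟨ha.le, hb.le⟩)
    simp only [dd_green_field hO hU hW hyO, lap]
    ring
  rw [← integral_sub hi1 hi2, hcongr, hdiv]
  ring

lemma rotDil_ray (χ ψ r b : ℝ) : rotDil χ ψ (r * Real.cos b, r * Real.sin b) =
    (χ * r * Real.cos (b + ψ), χ * r * Real.sin (b + ψ)) := by
  simp only [rotDil, Real.cos_add, Real.sin_add, Prod.mk.injEq]
  constructor <;> ring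

lemma hasDerivAt_ray {W : ℝ × ℝ → ℂ} {O : Set (ℝ × ℝ)} (hO : IsOpen O)
    (hW : ContDiffOn ℝ (⊤ : ℕ∞) W O) {b c r : ℝ} (h : (c * r * Real.cos b, c * r * Real.sin b) ∈ O) :
    HasDerivAt (fun r : ℝ => W (c * r * Real.cos b, c * r * Real.sin b))
      (c * dd W (Real.cos b, Real.sin b) (c * r * Real.cos b, c * r * Real.sin b)) r := by
  have h1 : HasDerivAt (fun r : ℝ => c * r) c r := by simpa using (hasDerivAt_id r).const_mul c
  have h2 := (h1.mul_const (Real.cos b)).prodMk (h1.mul_const (Real.sin b))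
  have h3 := ((hW.contDiffAt (hO.mem_nhds h)).differentiableAt (by simp)).hasFDerivAt
  have h4 := h3.comp_hasDerivAt r h2
  have h5 : (c * Real.cos b, c * Real.sin b) = c • (Real.cos b, Real.sin b) := rfl
  rw [h5, map_smul, Complex.real_smul] at h4
  exact h4

/-- Integration by parts along two rays related by a rotation and a dilation. -/
lemma rayInt_rotDil_by_parts {b₁ b₂ χ : ℝ} (hχ : 0 < χ) {O O' K : Set (ℝ × ℝ)}
    {U W : ℝ × ℝ → ℂ} (hO : IsOpen O) (hO' : IsOpen O')
    (hU : ContDiffOn ℝ (⊤ : ℕ∞) U O) (hW : ContDiffOn ℝ (⊤ : ℕ∞) W O')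
    (hmem : ∀ r : ℝ, 0 < r → polarCoord.symm (r, b₂) ∈ O)
    (hmem' : ∀ r : ℝ, 0 < r → polarCoord.symm (r, b₁) ∈ O')
    (hK : IsCompact K) (h0 : (0 : ℝ × ℝ) ∉ K) (hUK : ∀ y ∉ K, U y = 0) :
    IntegrableOn (fun r : ℝ => dd U (Real.cos b₂, Real.sin b₂)
        (rotDil χ (b₂ - b₁) (r * Real.cos b₁, r * Real.sin b₁)) *
        W (r * Real.cos b₁, r * Real.sin b₁)) (Ioi 0) ∧
    IntegrableOn (fun r : ℝ => U (r * Real.cos b₂, r * Real.sin b₂) *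
        dd W (Real.cos b₁, Real.sin b₁)
          (rotDil (1 / χ) (-(b₂ - b₁)) (r * Real.cos b₂, r * Real.sin b₂))) (Ioi 0) ∧
    rayInt b₁ (fun y => dd U (Real.cos b₂, Real.sin b₂) (rotDil χ (b₂ - b₁) y) * W y) =
      -((((1 / χ : ℝ) ^ 2 : ℝ) : ℂ) * rayInt b₂ (fun y => U y *
        dd W (Real.cos b₁, Real.sin b₁) (rotDil (1 / χ) (-(b₂ - b₁)) y))) := by
  obtain ⟨ε, R, hε, hεR, H⟩ := exists_annulus hK h0
  have hddU := dd_eq_zero_of_notMem hK.isClosed hUK (Real.cos b₂, Real.sin b₂)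
  have hχ' : 0 < 1 / χ := by positivity
  have e1 : b₁ + (b₂ - b₁) = b₂ := by ring
  have e2 : b₂ + -(b₂ - b₁) = b₁ := by ring
  simp only [rayInt, rotDil_ray, e1, e2]
  set u : ℝ → ℂ := fun r => U (r * Real.cos b₂, r * Real.sin b₂) with hu
  set u' : ℝ → ℂ := fun r =>
    dd U (Real.cos b₂, Real.sin b₂) (r * Real.cos b₂, r * Real.sin b₂) with hu'
  set w : ℝ → ℂ := fun r => W (r * Real.cos b₁, r * Real.sin b₁) with hw
  set w' : ℝ → ℂ := fun r =>
    dd W (Real.cos b₁, Real.sin b₁) (r * Real.cos b₁, r * Real.sin b₁) with hw'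
  have hz : ∀ r, 0 < r → ¬(ε < r ∧ r < R) → u r = 0 ∧ u' r = 0 := fun r hr hn =>
    have hk : (r * Real.cos b₂, r * Real.sin b₂) ∉ K := fun hk => hn (H r b₂ hr hk)
    ⟨hUK _ hk, hddU _ hk⟩
  have huc : ContinuousOn u (Ioi 0) :=
    hU.continuousOn.comp (f := fun r : ℝ => (r * Real.cos b₂, r * Real.sin b₂)) (by fun_prop)
      fun r hr => hmem r hr
  have huc' : ContinuousOn u' (Ioi 0) := (contDiffOn_dd hO hU _).continuousOn.comp
    (f := fun r : ℝ => (r * Real.cos b₂, r * Real.sin b₂)) (by fun_prop) fun r hr => hmem r hr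
  have hwc : ContinuousOn w (Ioi 0) :=
    hW.continuousOn.comp (f := fun r : ℝ => (r * Real.cos b₁, r * Real.sin b₁)) (by fun_prop)
      fun r hr => hmem' r hr
  have hwc' : ContinuousOn w' (Ioi 0) := (contDiffOn_dd hO' hW _).continuousOn.comp
    (f := fun r : ℝ => (r * Real.cos b₁, r * Real.sin b₁)) (by fun_prop) fun r hr => hmem' r hr
  have hscale : ∀ {c : ℝ}, 0 < c → MapsTo (fun r : ℝ => c * r) (Ioi 0) (Ioi 0) :=
    fun hc r hr => mul_pos hc hr
  have hint1 : IntegrableOn (fun r => u' (χ * r) * w r) (Ioi 0) := by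
    refine integrableOn_Ioi_of_annulus (ε := ε / χ) (R := R / χ) (by positivity)
      ((huc'.comp (by fun_prop) (hscale hχ)).mul hwc) fun r hr hne => ?_
    by_contra hn
    refine hne ?_
    rw [(hz (χ * r) (mul_pos hχ hr) fun h => hn ?_).2, zero_mul]
    exact ⟨(div_lt_iff₀' hχ).2 h.1, (lt_div_iff₀' hχ).2 h.2⟩
  have hint2 : IntegrableOn (fun r => u r * w' (1 / χ * r)) (Ioi 0) := by
    refine integrableOn_Ioi_of_annulus (ε := ε) (R := R) hε
      (huc.mul (hwc'.comp (by fun_prop) (hscale hχ'))) fun r hr hne => ?_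
    by_contra hn
    exact hne (by rw [(hz r hr hn).1, zero_mul])
  have hint3 : IntegrableOn (fun r => u' r * w (1 / χ * r)) (Ioi 0) := by
    refine integrableOn_Ioi_of_annulus (ε := ε) (R := R) hε
      (huc'.mul (hwc.comp (by fun_prop) (hscale hχ'))) fun r hr hne => ?_
    by_contra hn
    exact hne (by rw [(hz r hr hn).2, zero_mul])
  refine ⟨hint1, hint2, ?_⟩
  have hdu : ∀ r ∈ Ioi (0 : ℝ), HasDerivAt u (u' r) r := fun r hr => by
    simpa only [one_mul, Complex.ofReal_one] using
      hasDerivAt_ray hO hU (b := b₂) (c := 1) (r := r) (by rw [one_mul]; exact hmem r hr)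
  have hdw : ∀ r ∈ Ioi (0 : ℝ), HasDerivAt (fun r => w (1 / χ * r))
      (((1 / χ : ℝ) : ℂ) * w' (1 / χ * r)) r := fun r hr =>
    hasDerivAt_ray hO' hW (hmem' _ (mul_pos hχ' hr))
  have hlim0 : Filter.Tendsto (u * fun r => w (1 / χ * r)) (nhdsWithin 0 (Ioi 0)) (nhds 0) := by
    refine tendsto_const_nhds.congr' ?_
    filter_upwards [Ioo_mem_nhdsGT hε] with r hr
    rw [Pi.mul_apply, (hz r hr.1 fun h => lt_asymm h.1 hr.2).1, zero_mul]
  have hlim1 : Filter.Tendsto (u * fun r => w (1 / χ * r)) Filter.atTop (nhds 0) := by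
    refine tendsto_const_nhds.congr' ?_
    filter_upwards [Filter.eventually_gt_atTop R] with r hr
    rw [Pi.mul_apply, (hz r (hε.trans (hεR.trans hr)) fun h => lt_asymm h.2 hr).1, zero_mul]
  have hint4 : IntegrableOn (fun r => ((1 / χ : ℝ) : ℂ) * (u r * w' (1 / χ * r))) (Ioi 0) :=
    hint2.const_mul _
  have hparts := integral_Ioi_mul_deriv_eq_deriv_mul hdu hdw
    (hint4.congr_fun (fun r _ => by simp only [Pi.mul_apply]; ring) measurableSet_Ioi)
    hint3 hlim0 hlim1
  have hsub := integral_comp_mul_left_Ioi (fun s => u' s * w (1 / χ * s)) 0 hχ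
  have hcancel : ∀ r, 1 / χ * (χ * r) = r := fun r => by field_simp
  simp only [hcancel, mul_zero] at hsub
  have hpull : ∫ r in Ioi (0 : ℝ), u r * (((1 / χ : ℝ) : ℂ) * w' (1 / χ * r)) =
      ((1 / χ : ℝ) : ℂ) * ∫ r in Ioi (0 : ℝ), u r * w' (1 / χ * r) := by
    rw [← integral_const_mul]
    congr 1
    funext r
    ring
  rw [hpull] at hparts
  change _ = -(_ * ∫ r in Ioi (0 : ℝ), u r * w' (1 / χ * r))
  rw [hsub, Complex.real_smul, ← one_div]
  push_cast at hparts ⊢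
  linear_combination (1 / (χ : ℂ)) * hparts

/-- Nonlocal Green formula for `-Δ` in the plane angle `K` with the nonlocal
Neumann-type boundary operator `∂U/∂n₁|_{γ₁} + α (∂U/∂r)(χ₁₂ r, φ + φ₁₂)|_{γ₁}` (Example 2). -/
theorem green_formula_nonlocal_neumann
    (b₁ b₂ b₃ : ℝ) (hb₀ : 0 < b₁) (hb₁₂ : b₁ < b₂) (hb₂₃ : b₂ < b₃) (hb₃ : b₃ < 2 * π)
    (α χ₁₂ : ℝ) (hχ : 0 < χ₁₂)
    (U V₁ V₂ : ℝ × ℝ → ℂ)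
    (hU : SmoothNear U (closure (sector b₁ b₃) \ {0}))
    (hUc : HasCompactSupport U) (hU0 : (0 : ℝ × ℝ) ∉ tsupport U)
    (hV₁ : SmoothNear V₁ (closure (sector b₁ b₂) \ {0}))
    (hV₂ : SmoothNear V₂ (closure (sector b₂ b₃) \ {0})) :
    ((∫ y in sector b₁ b₂, (-(lap U y)) * conj (V₁ y)) +
      (∫ y in sector b₂ b₃, (-(lap U y)) * conj (V₂ y))) +
    rayInt b₁ (fun y => (dd U (-Real.sin b₁, Real.cos b₁) y +
        (α : ℂ) * dd U (Real.cos b₂, Real.sin b₂) (rotDil χ₁₂ (b₂ - b₁) y)) *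
      conj (-(V₁ y))) +
    rayInt b₃ (fun y => dd U (Real.sin b₃, -Real.cos b₃) y * conj (-(V₂ y))) +
    rayInt b₂ (fun y => dd U (-Real.sin b₂, Real.cos b₂) y * (conj (V₁ y) - conj (V₂ y))) =
    ((∫ y in sector b₁ b₂, U y * conj (-(lap V₁ y))) +
      (∫ y in sector b₂ b₃, U y * conj (-(lap V₂ y)))) +
    rayInt b₁ (fun y => (-(U y)) * conj (dd V₁ (-Real.sin b₁, Real.cos b₁) y)) +
    rayInt b₃ (fun y => (-(U y)) * conj (dd V₂ (Real.sin b₃, -Real.cos b₃) y)) +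
    rayInt b₂ (fun y => U y * conj (dd V₁ (-Real.sin b₂, Real.cos b₂) y -
      dd V₂ (-Real.sin b₂, Real.cos b₂) y +
      (α : ℂ) * (((1 / χ₁₂ : ℝ) ^ 2 : ℝ) : ℂ) *
        dd V₁ (Real.cos b₁, Real.sin b₁) (rotDil (1 / χ₁₂) (-(b₂ - b₁)) y))) := by
  obtain ⟨OU, hOU, hsubU, hU⟩ := hU
  obtain ⟨O₁, hO₁, hsub₁, hV₁⟩ := hV₁
  obtain ⟨O₂, hO₂, hsub₂, hV₂⟩ := hV₂
  have hK : IsCompact (tsupport U) := hUc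
  have hUK : ∀ y ∉ tsupport U, U y = 0 := fun y hy => image_eq_zero_of_notMem_tsupport hy
  have hddU := fun v => dd_eq_zero_of_notMem (isClosed_tsupport U) hUK v
  have hs₁ : closure (sector b₁ b₂) \ {0} ⊆ OU ∩ O₁ := by
    refine subset_inter (Subset.trans (sdiff_subset_sdiff_left (closure_mono ?_)) hsubU) hsub₁
    rintro y ⟨r, θ, hr, ha, hb, rfl⟩
    exact ⟨r, θ, hr, ha, hb.trans hb₂₃, rfl⟩
  have hs₂ : closure (sector b₂ b₃) \ {0} ⊆ OU ∩ O₂ := by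
    refine subset_inter (Subset.trans (sdiff_subset_sdiff_left (closure_mono ?_)) hsubU) hsub₂
    rintro y ⟨r, θ, hr, ha, hb, rfl⟩
    exact ⟨r, θ, hr, hb₁₂.trans ha, hb, rfl⟩
  have green₁ := green_sector hb₁₂ (by linarith) (hOU.inter hO₁) hs₁
    (hU.mono inter_subset_left) (hV₁.mono inter_subset_right) hK hU0 hUK
  have green₂ := green_sector hb₂₃ (by linarith) (hOU.inter hO₂) hs₂
    (hU.mono inter_subset_left) (hV₂.mono inter_subset_right) hK hU0 hUK
  have hm₁₁ : ∀ r : ℝ, 0 < r → polarCoord.symm (r, b₁) ∈ OU ∩ O₁ := fun r hr =>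
    hs₁ (polarCoord_symm_mem_closure_sector hb₁₂ hr (left_mem_Icc.2 hb₁₂.le))
  have hm₁₂ : ∀ r : ℝ, 0 < r → polarCoord.symm (r, b₂) ∈ OU ∩ O₁ := fun r hr =>
    hs₁ (polarCoord_symm_mem_closure_sector hb₁₂ hr (right_mem_Icc.2 hb₁₂.le))
  have hm₂₂ : ∀ r : ℝ, 0 < r → polarCoord.symm (r, b₂) ∈ OU ∩ O₂ := fun r hr =>
    hs₂ (polarCoord_symm_mem_closure_sector hb₂₃ hr (left_mem_Icc.2 hb₂₃.le))
  obtain ⟨hi₁, hi₂, hnonlocal⟩ := rayInt_rotDil_by_parts hχ hOU hO₁ hU (contDiffOn_conj hV₁)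
    (b₁ := b₁) (b₂ := b₂) (fun r hr => (hm₁₂ r hr).1) (fun r hr => (hm₁₁ r hr).2) hK hU0 hUK
  simp only [dd_conj] at hi₂ hnonlocal
  have intN : ∀ {O : Set (ℝ × ℝ)} {V : ℝ × ℝ → ℂ} {b : ℝ} (v : ℝ × ℝ),
      ContDiffOn ℝ (⊤ : ℕ∞) V O →
      (∀ r : ℝ, 0 < r → polarCoord.symm (r, b) ∈ OU ∩ O) →
      IntegrableOn (fun r : ℝ => dd U v (r * Real.cos b, r * Real.sin b) *
        conj (V (r * Real.cos b, r * Real.sin b))) (Ioi 0) := fun {O V b} v hV hm =>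
    integrableOn_ray (h := fun y => dd U v y * conj (V y)) hm
      (((contDiffOn_dd hOU hU v).continuousOn.mono inter_subset_left).mul
        ((contDiffOn_conj hV).continuousOn.mono inter_subset_right)) hK hU0
      fun y hy => by rw [hddU v y hy, zero_mul]
  have intD : ∀ {O : Set (ℝ × ℝ)} {V : ℝ × ℝ → ℂ} {b : ℝ} (v : ℝ × ℝ), IsOpen O →
      ContDiffOn ℝ (⊤ : ℕ∞) V O →
      (∀ r : ℝ, 0 < r → polarCoord.symm (r, b) ∈ OU ∩ O) →
      IntegrableOn (fun r : ℝ => U (r * Real.cos b, r * Real.sin b) *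
        conj (dd V v (r * Real.cos b, r * Real.sin b))) (Ioi 0) := fun {O V b} v hO hV hm =>
    integrableOn_ray (h := fun y => U y * conj (dd V v y)) hm
      ((hU.continuousOn.mono inter_subset_left).mul
        ((contDiffOn_conj (contDiffOn_dd hO hV v)).continuousOn.mono inter_subset_right)) hK hU0
      fun y hy => by rw [hUK y hy, zero_mul]
  have hflip : ∀ (W : ℝ × ℝ → ℂ) y, dd W (Real.sin b₃, -Real.cos b₃) y =
      -dd W (-Real.sin b₃, Real.cos b₃) y := fun W y => by
    rw [dd_comb, dd_comb W (-Real.sin b₃)]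
    push_cast
    ring
  have e₁ : rayInt b₁ (fun y => (dd U (-Real.sin b₁, Real.cos b₁) y +
        (α : ℂ) * dd U (Real.cos b₂, Real.sin b₂) (rotDil χ₁₂ (b₂ - b₁) y)) *
      conj (-(V₁ y))) =
      -rayInt b₁ (fun y => dd U (-Real.sin b₁, Real.cos b₁) y * conj (V₁ y)) -
      α * rayInt b₁ (fun y => dd U (Real.cos b₂, Real.sin b₂) (rotDil χ₁₂ (b₂ - b₁) y) *
        conj (V₁ y)) := by
    simp only [rayInt]
    rw [← integral_neg, ← integral_const_mul,
      ← integral_sub (intN (-Real.sin b₁, Real.cos b₁) hV₁ hm₁₁).fun_neg (hi₁.const_mul (α : ℂ))]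
    congr 1
    funext r
    simp only [map_neg]
    ring
  have e₃ : rayInt b₃ (fun y => dd U (Real.sin b₃, -Real.cos b₃) y * conj (-(V₂ y))) =
      rayInt b₃ (fun y => dd U (-Real.sin b₃, Real.cos b₃) y * conj (V₂ y)) := by
    simp only [hflip, map_neg, neg_mul_neg]
  have e₂ : rayInt b₂ (fun y => dd U (-Real.sin b₂, Real.cos b₂) y *
        (conj (V₁ y) - conj (V₂ y))) =
      rayInt b₂ (fun y => dd U (-Real.sin b₂, Real.cos b₂) y * conj (V₁ y)) -
      rayInt b₂ (fun y => dd U (-Real.sin b₂, Real.cos b₂) y * conj (V₂ y)) := by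
    simp only [rayInt]
    rw [← integral_sub (intN _ hV₁ hm₁₂) (intN _ hV₂ hm₂₂)]
    simp only [mul_sub]
  have f₁ : rayInt b₁ (fun y => (-(U y)) * conj (dd V₁ (-Real.sin b₁, Real.cos b₁) y)) =
      -rayInt b₁ (fun y => U y * conj (dd V₁ (-Real.sin b₁, Real.cos b₁) y)) := by
    simp only [rayInt, neg_mul, integral_neg]
  have f₃ : rayInt b₃ (fun y => (-(U y)) * conj (dd V₂ (Real.sin b₃, -Real.cos b₃) y)) =
      rayInt b₃ (fun y => U y * conj (dd V₂ (-Real.sin b₃, Real.cos b₃) y)) := by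
    simp only [hflip, map_neg, neg_mul_neg]
  have f₂ : rayInt b₂ (fun y => U y * conj (dd V₁ (-Real.sin b₂, Real.cos b₂) y -
      dd V₂ (-Real.sin b₂, Real.cos b₂) y +
      (α : ℂ) * (((1 / χ₁₂ : ℝ) ^ 2 : ℝ) : ℂ) *
        dd V₁ (Real.cos b₁, Real.sin b₁) (rotDil (1 / χ₁₂) (-(b₂ - b₁)) y))) =
      rayInt b₂ (fun y => U y * conj (dd V₁ (-Real.sin b₂, Real.cos b₂) y)) -
      rayInt b₂ (fun y => U y * conj (dd V₂ (-Real.sin b₂, Real.cos b₂) y)) +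
      (α : ℂ) * (((1 / χ₁₂ : ℝ) ^ 2 : ℝ) : ℂ) * rayInt b₂ (fun y => U y *
        conj (dd V₁ (Real.cos b₁, Real.sin b₁) (rotDil (1 / χ₁₂) (-(b₂ - b₁)) y))) := by
    have h₁ := intD (-Real.sin b₂, Real.cos b₂) hO₁ hV₁ hm₁₂
    have h₂ := intD (-Real.sin b₂, Real.cos b₂) hO₂ hV₂ hm₂₂
    simp only [rayInt]
    rw [← integral_sub h₁ h₂, ← integral_const_mul, ← integral_add (h₁.fun_sub h₂) (hi₂.const_mul _)]
    congr 1
    funext r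
    simp only [map_add, map_sub, map_mul, Complex.conj_ofReal]
    ring
  rw [e₁, e₂, e₃, f₁, f₂, f₃]
  linear_combination green₁ + green₂ - (α : ℂ) * hnonlocal
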